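/- (Lyapunov inequality for the generator.) Let d ∈ ℕ, p ≥ 1 a real number, and define V_p : ℝᵈ → ℝ by V_p(x) = √(1 + |x|^{2p}). Let β : [0,∞) × ℝᵈ → ℝᵈ, α : [0,∞) × ℝᵈ → ℝᵈ and σ : ℝᵈ → ℝ^{d×d}, and suppose there are constants κ₊ > 0 and C_β, C_α, C_Σ ≥ 0 such that for all s ≥ 0 and x ∈ ℝᵈ: ⟨β_s(x), x⟩ ≤ −κ₊·|x|² + C_β, |α_s(x)| ≤ C_α, and ‖σ(x)σ(x)ᵀ‖_F ≤ C_Σ. Then there exist constants λ_p > 0 and C_p ≥ 0 such that for all s ≥ 0 and x ∈ ℝᵈ: ⟨β_s(x) + α_s(x), ∇V_p(x)⟩ + tr(σ(x)σ(x)ᵀ·∇²V_p(x)) ≤ −λ_p·V_p(x) + C_p. -/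

import Mathlib

open Matrix RealInnerProductSpace

noncomputable section

/-- The Lyapunov function `V_p(x) = √(1 + |x|^{2p})`. -/
def Vp (d : ℕ) (p : ℝ) (x : EuclideanSpace ℝ (Fin d)) : ℝ :=
  Real.sqrt (1 + ‖x‖ ^ (2 * p))

/-- The scalar factor in `∇V_p(x) = radialFactor p (‖x‖ ^ 2) • x`. -/
def radialFactor (p q : ℝ) : ℝ :=
  p * q ^ (p - 1) / Real.sqrt (1 + q ^ p)

theorem Vp_eq (d : ℕ) (p : ℝ) (x : EuclideanSpace ℝ (Fin d)) :
    Vp d p x = Real.sqrt (1 + (‖x‖ ^ 2) ^ p) := by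
  rw [Vp, Real.rpow_mul (norm_nonneg x), Real.rpow_two]

theorem radialFactor_nonneg {p q : ℝ} (hp : 0 ≤ p) (hq : 0 ≤ q) : 0 ≤ radialFactor p q := by
  unfold radialFactor
  positivity

theorem hasDerivAt_sqrt_one_add_rpow (p : ℝ) {q : ℝ} (hq : 0 < q) :
    HasDerivAt (fun q : ℝ => Real.sqrt (1 + q ^ p)) (radialFactor p q / 2) q := by
  have h := ((Real.hasDerivAt_rpow_const (p := p) (Or.inl hq.ne')).const_add 1).sqrt
    (by positivity)
  convert h using 1
  unfold radialFactor
  field_simp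

theorem hasFDerivAt_norm_sq {E : Type*} [NormedAddCommGroup E] [InnerProductSpace ℝ E] (x : E) :
    HasFDerivAt (fun y : E => ‖y‖ ^ 2) (2 • innerSL ℝ x) x :=
  (hasStrictFDerivAt_norm_sq x).hasFDerivAt

theorem hasFDerivAt_Vp (d : ℕ) (p : ℝ) {x : EuclideanSpace ℝ (Fin d)} (hx : x ≠ 0) :
    HasFDerivAt (Vp d p) (radialFactor p (‖x‖ ^ 2) • innerSL ℝ x) x := by
  have hq : 0 < ‖x‖ ^ 2 := by positivity
  have h := (hasDerivAt_sqrt_one_add_rpow p hq).comp_hasFDerivAt x (hasFDerivAt_norm_sq x)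
  have hV : Vp d p = (fun q : ℝ => Real.sqrt (1 + q ^ p)) ∘ fun y => ‖y‖ ^ 2 :=
    funext (Vp_eq d p)
  rw [hV]
  refine h.congr_fderiv ?_
  ext v
  simp
  ring

theorem gradient_Vp (d : ℕ) (p : ℝ) {x : EuclideanSpace ℝ (Fin d)} (hx : x ≠ 0) :
    gradient (Vp d p) x = radialFactor p (‖x‖ ^ 2) • x := by
  apply HasGradientAt.gradient
  rw [hasGradientAt_iff_hasFDerivAt]
  refine (hasFDerivAt_Vp d p hx).congr_fderiv ?_
  ext v
  simp

theorem gradient_Vp_zero (d : ℕ) {p : ℝ} (hp : 0 < p) : gradient (Vp d p) 0 = 0 := by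
  have h : IsLocalMin (Vp d p) 0 := Filter.Eventually.of_forall fun y => by
    simp only [Vp]
    apply Real.sqrt_le_sqrt
    rw [norm_zero, Real.zero_rpow (by positivity)]
    gcongr
    positivity
  rw [gradient, h.fderiv_eq_zero, map_zero]

theorem exists_hasDerivAt_radialFactor {p q : ℝ} (hp : 1 ≤ p) (hq : 0 < q) :
    ∃ g', HasDerivAt (radialFactor p) g' q ∧ |g'| * q ≤ 2 * p * radialFactor p q := by
  have hS : 0 < Real.sqrt (1 + q ^ p) := by positivity
  have hnum : HasDerivAt (fun q : ℝ => p * q ^ (p - 1)) (p * ((p - 1) * q ^ (p - 1 - 1))) q :=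
    (Real.hasDerivAt_rpow_const (Or.inl hq.ne')).const_mul p
  refine ⟨_, hnum.div (hasDerivAt_sqrt_one_add_rpow p hq) hS.ne', ?_⟩
  rw [← abs_of_pos hq, ← abs_mul, abs_of_pos hq]
  have hS2 : Real.sqrt (1 + q ^ p) ^ 2 = 1 + q ^ p := Real.sq_sqrt (by positivity)
  have hq1 : q ^ (p - 1) = q ^ (p - 1 - 1) * q := by
    rw [← Real.rpow_add_one hq.ne']; ring_nf
  have hqp : q ^ p = q ^ (p - 1) * q := by
    rw [← Real.rpow_add_one hq.ne']; ring_nf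
  have hw : 0 < q ^ (p - 1) := by positivity
  have key : (p * ((p - 1) * q ^ (p - 1 - 1)) * Real.sqrt (1 + q ^ p) -
      p * q ^ (p - 1) * (radialFactor p q / 2)) / Real.sqrt (1 + q ^ p) ^ 2 * q =
      radialFactor p q * ((p - 1) - p / 2 * (q ^ p / (1 + q ^ p))) := by
    have e : q ^ p / (1 + q ^ p) = q ^ (p - 1) * q / Real.sqrt (1 + q ^ p) ^ 2 := by
      rw [hS2, ← hqp]
    rw [e]
    unfold radialFactor
    generalize Real.sqrt (1 + q ^ p) = S at *
    rw [hq1]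
    field_simp
  rw [key, abs_mul, abs_of_nonneg (radialFactor_nonneg (by linarith) hq.le), mul_comm]
  refine mul_le_mul_of_nonneg_right ?_ (radialFactor_nonneg (by linarith) hq.le)
  have h0 : 0 ≤ q ^ p / (1 + q ^ p) := by positivity
  have h1 : q ^ p / (1 + q ^ p) ≤ 1 := by
    rw [div_le_one (by positivity)]
    linarith
  rw [abs_le]
  constructor <;> nlinarith

theorem abs_iteratedFDeriv_two_Vp_le (d : ℕ) {p : ℝ} (hp : 1 ≤ p)
    {x : EuclideanSpace ℝ (Fin d)} (hx : x ≠ 0) (u v : EuclideanSpace ℝ (Fin d)) :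
    |iteratedFDeriv ℝ 2 (Vp d p) x ![u, v]| ≤
      5 * p * radialFactor p (‖x‖ ^ 2) * (‖u‖ * ‖v‖) := by
  have hq : 0 < ‖x‖ ^ 2 := by positivity
  obtain ⟨g', hg', hbound⟩ := exists_hasDerivAt_radialFactor hp hq
  have hfd : fderiv ℝ (Vp d p) =ᶠ[nhds x]
      fun y => radialFactor p (‖y‖ ^ 2) • innerSL ℝ y := by
    filter_upwards [isOpen_ne.mem_nhds hx] with y hy
    exact (hasFDerivAt_Vp d p hy).fderiv
  have h2 := (hg'.comp_hasFDerivAt x (hasFDerivAt_norm_sq x)).smul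
    (innerSL ℝ (E := EuclideanSpace ℝ (Fin d))).hasFDerivAt
  have heq : iteratedFDeriv ℝ 2 (Vp d p) x ![u, v] =
      g' * 2 * (⟪x, u⟫ * ⟪x, v⟫) + radialFactor p (‖x‖ ^ 2) * ⟪u, v⟫ := by
    rw [iteratedFDeriv_two_apply, hfd.fderiv_eq]
    erw [h2.fderiv]
    simp
    erw [innerSL_apply_apply, innerSL_apply_apply]
    ring
  have hg := radialFactor_nonneg (p := p) (by linarith) hq.le
  have hxx : |⟪x, u⟫ * ⟪x, v⟫| ≤ ‖x‖ ^ 2 * (‖u‖ * ‖v‖) := by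
    rw [abs_mul]
    calc _ ≤ (‖x‖ * ‖u‖) * (‖x‖ * ‖v‖) := by
          gcongr <;> exact abs_real_inner_le_norm _ _
      _ = _ := by ring
  have huv : 0 ≤ ‖u‖ * ‖v‖ := by positivity
  rw [heq]
  calc _ ≤ |g'| * 2 * |⟪x, u⟫ * ⟪x, v⟫| + radialFactor p (‖x‖ ^ 2) * |⟪u, v⟫| := by
        refine (abs_add_le _ _).trans_eq ?_
        rw [abs_mul, abs_mul, abs_mul (radialFactor _ _), abs_of_nonneg hg, abs_two]
    _ ≤ |g'| * 2 * (‖x‖ ^ 2 * (‖u‖ * ‖v‖)) + radialFactor p (‖x‖ ^ 2) * (‖u‖ * ‖v‖) := by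
        gcongr
        exact abs_real_inner_le_norm _ _
    _ = (2 * (|g'| * ‖x‖ ^ 2) + radialFactor p (‖x‖ ^ 2)) * (‖u‖ * ‖v‖) := by ring
    _ ≤ _ := by
        gcongr
        nlinarith

theorem abs_entry_le_sqrt_sum_sq {m n : Type*} [Fintype m] [Fintype n] (A : Matrix m n ℝ)
    (i : m) (j : n) : |A i j| ≤ Real.sqrt (∑ i, ∑ j, A i j ^ 2) := by
  apply Real.abs_le_sqrt
  calc A i j ^ 2 ≤ ∑ j, A i j ^ 2 :=
        Finset.single_le_sum (f := fun j => A i j ^ 2) (fun _ _ => sq_nonneg _) (Finset.mem_univ j)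
    _ ≤ _ := Finset.single_le_sum (f := fun i => ∑ j, A i j ^ 2)
        (fun _ _ => Finset.sum_nonneg fun _ _ => sq_nonneg _) (Finset.mem_univ i)

theorem sum_mul_le_of_abs_le {m n : Type*} [Fintype m] [Fintype n] {A H : m → n → ℝ} {C : ℝ}
    (hA : ∀ i j, |A i j| ≤ C) :
    ∑ i, ∑ j, A i j * H i j ≤ C * ∑ i, ∑ j, |H i j| := by
  simp only [Finset.mul_sum]
  refine Finset.sum_le_sum fun i _ => Finset.sum_le_sum fun j _ => ?_
  calc A i j * H i j ≤ |A i j| * |H i j| := by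
        rw [← abs_mul]
        exact le_abs_self _
    _ ≤ _ := by gcongr; exact hA i j

/-- A radial drift that is eventually confining is dominated by `-√(1 + q ^ p)`. -/
theorem radialFactor_mul_le {p κ M q : ℝ} (hp : 1 ≤ p) (hκ : 0 < κ) (hM : 0 ≤ M) (hq : 0 < q) :
    radialFactor p q * (-(κ / 2) * q + M) ≤
      -(p * κ / 4) * Real.sqrt (1 + q ^ p) +
        (p * κ / 4 + p * M * (4 * M / κ) ^ (p - 1)) := by
  have hS1 : 1 ≤ Real.sqrt (1 + q ^ p) := by
    rw [Real.one_le_sqrt]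
    have : 0 ≤ q ^ p := by positivity
    linarith
  have hS2 : Real.sqrt (1 + q ^ p) ^ 2 = 1 + q ^ p := Real.sq_sqrt (by positivity)
  have hqp : q ^ p = q ^ (p - 1) * q := by
    rw [← Real.rpow_add_one hq.ne']; ring_nf
  have hw : 0 < q ^ (p - 1) := by positivity
  have hR : 0 ≤ (4 * M / κ) ^ (p - 1) := by positivity
  have main : p * M * q ^ (p - 1) ≤
      p * κ / 4 * (q ^ (p - 1) * q) + p * M * (4 * M / κ) ^ (p - 1) := by
    rcases le_total q (4 * M / κ) with h | h
    · have : q ^ (p - 1) ≤ (4 * M / κ) ^ (p - 1) :=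
        Real.rpow_le_rpow hq.le h (by linarith)
      have h1 : p * M * q ^ (p - 1) ≤ p * M * (4 * M / κ) ^ (p - 1) := by gcongr
      have h2 : 0 ≤ p * κ / 4 * (q ^ (p - 1) * q) := by positivity
      linarith
    · rw [div_le_iff₀ hκ] at h
      have h1 : p * q ^ (p - 1) * (4 * M) ≤ p * q ^ (p - 1) * (q * κ) := by gcongr
      have h2 : 0 ≤ p * M * (4 * M / κ) ^ (p - 1) := by positivity
      linarith
  unfold radialFactor
  rw [div_mul_eq_mul_div, div_le_iff₀ (by linarith)]
  have hC : 0 ≤ p * κ / 4 + p * M * (4 * M / κ) ^ (p - 1) := by positivity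
  have h3 := mul_le_mul_of_nonneg_left hS1 hC
  have h4 := congrArg (p * κ / 4 * ·) hS2
  simp only [hqp] at h3 h4 ⊢
  linarith

/-- Lyapunov inequality for the generator: under a confinement condition on
`β`, boundedness of `α` and of `σσᵀ`, there are `λ_p > 0` and `C_p ≥ 0` with
`⟨β_s(x)+α_s(x), ∇V_p(x)⟩ + tr(σ(x)σ(x)ᵀ ∇²V_p(x)) ≤ −λ_p V_p(x) + C_p`
for all `s ≥ 0` and `x ∈ ℝᵈ`. -/
theorem stmt19 (d : ℕ) (p : ℝ) (hp : 1 ≤ p)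
    (β α : ℝ → EuclideanSpace ℝ (Fin d) → EuclideanSpace ℝ (Fin d))
    (σ : EuclideanSpace ℝ (Fin d) → Matrix (Fin d) (Fin d) ℝ)
    (κ Cβ Cα CSg : ℝ) (hκ : 0 < κ) (hCβ : 0 ≤ Cβ) (hCα : 0 ≤ Cα) (hCSg : 0 ≤ CSg)
    (hβ : ∀ s x, 0 ≤ s → ⟪β s x, x⟫ ≤ -κ * ‖x‖ ^ 2 + Cβ)
    (hα : ∀ s x, 0 ≤ s → ‖α s x‖ ≤ Cα)
    (hσ : ∀ x, Real.sqrt (∑ i, ∑ j, ((σ x * (σ x)ᵀ) i j) ^ 2) ≤ CSg) :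
    ∃ lamp : ℝ, 0 < lamp ∧ ∃ Cp : ℝ, 0 ≤ Cp ∧ ∀ s x, 0 ≤ s →
      ⟪β s x + α s x, gradient (Vp d p) x⟫ +
        ∑ i, ∑ j, (σ x * (σ x)ᵀ) i j *
          iteratedFDeriv ℝ 2 (Vp d p) x
            ![EuclideanSpace.single i 1, EuclideanSpace.single j 1] ≤
      -lamp * Vp d p x + Cp := by
  have hA : ∀ x i j, |(σ x * (σ x)ᵀ) i j| ≤ CSg := fun x i j =>
    (abs_entry_le_sqrt_sum_sq _ i j).trans (hσ x)
  let H (x : EuclideanSpace ℝ (Fin d)) (i j : Fin d) : ℝ := iteratedFDeriv ℝ 2 (Vp d p) x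
    ![EuclideanSpace.single i 1, EuclideanSpace.single j 1]
  have hH (x) := sum_mul_le_of_abs_le (H := H x) (hA x)
  set M : ℝ := Cβ + Cα ^ 2 / (2 * κ) + CSg * (d * d * (5 * p)) with hM_def
  have hM : 0 ≤ M := by positivity
  set C₁ : ℝ := p * κ / 4 + p * M * (4 * M / κ) ^ (p - 1)
  have hC₁ : 0 ≤ C₁ := by positivity
  set C₀ : ℝ := p * κ / 4 * Vp d p 0 + CSg * ∑ i, ∑ j, |H 0 i j|
  have hC₀ : 0 ≤ C₀ := by
    have : 0 ≤ Vp d p 0 := Real.sqrt_nonneg _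
    have : 0 ≤ ∑ i, ∑ j, |H 0 i j| := by positivity
    positivity
  refine ⟨p * κ / 4, by positivity, C₁ + C₀, by positivity, fun s x hs => ?_⟩
  refine (add_le_add_right (hH x) _).trans ?_
  by_cases hx : x = 0
  · subst hx
    rw [gradient_Vp_zero d (by linarith), inner_zero_right]
    simp only [C₀]
    linarith
  have hq : 0 < ‖x‖ ^ 2 := by positivity
  have hg := radialFactor_nonneg (p := p) (by linarith) hq.le
  have hHsum : ∑ i, ∑ j, |H x i j| ≤ d * d * (5 * p) * radialFactor p (‖x‖ ^ 2) := by
    calc ∑ i, ∑ j, |H x i j| ≤ ∑ _i : Fin d, ∑ _j : Fin d, 5 * p * radialFactor p (‖x‖ ^ 2) := by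
          gcongr with i _ j _
          simpa using abs_iteratedFDeriv_two_Vp_le d hp hx
            (EuclideanSpace.single i 1) (EuclideanSpace.single j 1)
      _ = _ := by
          simp
          ring
  have hdrift : ⟪β s x + α s x, x⟫ ≤ -(κ / 2) * ‖x‖ ^ 2 + (Cβ + Cα ^ 2 / (2 * κ)) := by
    have h1 : ⟪α s x, x⟫ ≤ Cα * ‖x‖ :=
      (real_inner_le_norm _ _).trans (by gcongr; exact hα s x hs)
    have h2 : Cα * ‖x‖ ≤ κ / 2 * ‖x‖ ^ 2 + Cα ^ 2 / (2 * κ) := by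
      have h : κ / 2 * ‖x‖ ^ 2 + Cα ^ 2 / (2 * κ) - Cα * ‖x‖ =
          (κ * ‖x‖ - Cα) ^ 2 / (2 * κ) := by
        field_simp
        ring
      have : 0 ≤ (κ * ‖x‖ - Cα) ^ 2 / (2 * κ) := by positivity
      linarith
    rw [inner_add_left]
    linarith [hβ s x hs]
  rw [gradient_Vp d p hx, inner_smul_right, Vp_eq]
  have h1 := mul_le_mul_of_nonneg_left hdrift hg
  have h2 := mul_le_mul_of_nonneg_left hHsum hCSg
  have h3 := radialFactor_mul_le hp hκ hM hq
  calc _ ≤ radialFactor p (‖x‖ ^ 2) * (-(κ / 2) * ‖x‖ ^ 2 + M) := by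
        rw [hM_def]
        linarith
    _ ≤ _ := by
        simp only [C₁]
        linarith
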